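/- arXiv:1311.5014 — 3 statements merged into one kernel-verified Lean document; each statement's English description precedes it below -/
import Mathlib

section
/- Let 0 < α < 1 and 0 < c < 1. Let p : ℕ → ℝ with p(0) ≥ 0 satisfy the policing update p(t+1) = max(0, p(t) + α·(r(t) − 1)) for all t, where r(t) denotes the normalised attempt rate x(t)/x̄(t) at step t. Suppose that for all t the station is well-behaved, i.e. r(t) ≤ 1 − c·min(p(t), 1). Then p(t) converges to 0 as t → ∞. -/
/-- Theorem 1 (Well-behaved stations): if `0 < α < 1`, `0 < c < 1`, the penalty
evolves by `p (t+1) = max 0 (p t + α * (r t - 1))` with `p 0 ≥ 0`, and the station is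
well-behaved, i.e. `r t ≤ 1 - c * min (p t) 1` for all `t`, then `p t → 0`. -/
theorem policing_well_behaved_converges_to_zero
    (α c : ℝ) (hα0 : 0 < α) (hα1 : α < 1) (hc0 : 0 < c) (hc1 : c < 1)
    (p r : ℕ → ℝ) (hp0 : 0 ≤ p 0)
    (hupd : ∀ t, p (t + 1) = max 0 (p t + α * (r t - 1)))
    (hwb : ∀ t, r t ≤ 1 - c * min (p t) 1) :
    Filter.Tendsto p Filter.atTop (nhds 0) := by
  have hnonneg : ∀ t, 0 ≤ p t := by
    intro t
    cases t with
    | zero => exact hp0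
    | succ t => rw [hupd]; exact le_max_left _ _
  have hstep : ∀ t, p (t + 1) ≤ max 0 (p t - α * (c * min (p t) 1)) := by
    intro t
    rw [hupd]
    refine max_le_max le_rfl ?_
    have := mul_le_mul_of_nonneg_left (hwb t) hα0.le
    linarith
  have hanti : Antitone p := by
    refine antitone_nat_of_succ_le fun t => (hstep t).trans (max_le (hnonneg t) ?_)
    have hmin : 0 ≤ min (p t) 1 := le_min (hnonneg t) zero_le_one
    have : 0 ≤ α * (c * min (p t) 1) := by positivity
    linarith
  have hlim : Filter.Tendsto p Filter.atTop (nhds (⨅ t, p t)) :=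
    tendsto_atTop_ciInf hanti ⟨0, by rintro _ ⟨t, rfl⟩; exact hnonneg t⟩
  generalize (⨅ t, p t) = L at hlim
  have hL : 0 ≤ L := ge_of_tendsto' hlim hnonneg
  have hcont : Continuous fun x : ℝ => max 0 (x - α * (c * min x 1)) := by fun_prop
  have hfix : L ≤ max 0 (L - α * (c * min L 1)) :=
    le_of_tendsto_of_tendsto' (hlim.comp (Filter.tendsto_add_atTop_nat 1))
      ((hcont.tendsto L).comp hlim) hstep
  obtain rfl | hpos := hL.eq_or_lt
  · exact hlim
  · have hmin : 0 < min L 1 := lt_min hpos one_pos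
    have : 0 < α * (c * min L 1) := by positivity
    rcases le_max_iff.mp hfix with h | h <;> linarith
end

section
/- Let α > 0 and let h : ℝ → ℝ be strictly decreasing on [0,1] and Lipschitz on [0,1] with a Lipschitz constant K satisfying K < 2/α. Let P ∈ (0,1) satisfy h(P) = 1. Then for every p ∈ [0,1] with p ≠ P, one has (p + α·(h(p) − 1) − P)² < (p − P)². That is, one step of the (unclipped) policing update strictly decreases the Lyapunov function V(p) = (p − P)². -/
/-- Lyapunov decrease: if `α > 0`, `h` is strictly decreasing on `[0,1]` and Lipschitz
on `[0,1]` with constant `K < 2/α`, and `P ∈ (0,1)` satisfies `h P = 1`, then one step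
of the unclipped policing update strictly decreases `V p = (p - P)^2` at every
`p ∈ [0,1]` with `p ≠ P`. -/
theorem policing_lyapunov_strict_decrease
    (α K : ℝ) (hα : 0 < α)
    (h : ℝ → ℝ) (hanti : StrictAntiOn h (Set.Icc 0 1))
    (hlip : ∀ p ∈ Set.Icc (0 : ℝ) 1, ∀ q ∈ Set.Icc (0 : ℝ) 1, |h p - h q| ≤ K * |p - q|)
    (hK : K < 2 / α)
    (P : ℝ) (hP : P ∈ Set.Ioo (0 : ℝ) 1) (hfix : h P = 1) :
    ∀ p ∈ Set.Icc (0 : ℝ) 1, p ≠ P →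
      (p + α * (h p - 1) - P) ^ 2 < (p - P) ^ 2 := by
  intro p hp hne
  have hP' : P ∈ Set.Icc (0 : ℝ) 1 := Set.Ioo_subset_Icc_self hP
  have hαK : K * α < 2 := (lt_div_iff₀ hα).1 hK
  have hl := hlip p hp P hP'
  rw [hfix] at hl
  rcases lt_or_gt_of_ne hne with hlt | hgt
  · have he : 0 < h p - 1 := by linarith [hanti hp hP' hlt]
    rw [abs_of_pos he, abs_of_neg (sub_neg.2 hlt)] at hl
    have hstep : 2 * (p - P) + α * (h p - 1) < 0 := by
      nlinarith [mul_le_mul_of_nonneg_left hl hα.le, mul_pos (sub_pos.2 hαK) (sub_pos.2 hlt)]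
    linarith [mul_neg_of_pos_of_neg (mul_pos hα he) hstep]
  · have he : h p - 1 < 0 := by linarith [hanti hP' hp hgt]
    rw [abs_of_neg he, abs_of_pos (sub_pos.2 hgt)] at hl
    have hstep : 0 < 2 * (p - P) + α * (h p - 1) := by
      nlinarith [mul_le_mul_of_nonneg_left hl hα.le, mul_pos (sub_pos.2 hαK) (sub_pos.2 hgt)]
    linarith [mul_neg_of_neg_of_pos (mul_neg_of_pos_of_neg hα he) hstep]
end

section
/- Let 0 < α < 1 and let h : ℝ → ℝ be strictly decreasing on [0,1], Lipschitz on [0,1] with Lipschitz constant K < 2/α, with h(0) > 1 and h(1) < 1, and let P ∈ (0,1) be the unique point with h(P) = 1. Let p : ℕ → ℝ with p(0) ≥ 0 satisfy p(t+1) = max(0, p(t) + α·(h(min(p(t),1)) − 1)) for all t. Then p(t) converges to P as t → ∞; in particular the normalised attempt rate h(min(p(t),1)) converges to 1. -/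
open Filter Topology in
/-- Orbits of a continuous map on a closed subset of a proper space converge to the fixed point `a`
as soon as the map strictly decreases the distance to `a`. -/
theorem tendsto_orbit_of_dist_lt {X : Type*} [MetricSpace X] [ProperSpace X] {s : Set X}
    (hs : IsClosed s) {f : X → X} (hf : ContinuousOn f s) {a : X} (hfa : f a = a)
    (hlt : ∀ x ∈ s, x ≠ a → dist (f x) a < dist x a) {u : ℕ → X} (hu : ∀ n, u n ∈ s)
    (hsucc : ∀ n, u (n + 1) = f (u n)) : Tendsto u atTop (𝓝 a) := by
  have hanti : Antitone fun n => dist (u n) a := by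
    refine antitone_nat_of_succ_le fun n => ?_
    rw [hsucc]
    by_cases hn : u n = a
    · rw [hn, hfa]
    · exact (hlt _ (hu n) hn).le
  have hlim := tendsto_atTop_ciInf hanti ⟨0, by rintro _ ⟨n, rfl⟩; exact dist_nonneg⟩
  set d := ⨅ n, dist (u n) a
  obtain ⟨b, -, φ, hφ, hb⟩ := (isCompact_closedBall a (dist (u 0) a)).tendsto_subseq
    fun n => Metric.mem_closedBall.2 (hanti (Nat.zero_le n))
  have hbs : b ∈ s := hs.mem_of_tendsto hb (Eventually.of_forall fun n => hu _)
  have hbd : dist b a = d :=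
    tendsto_nhds_unique (hb.dist tendsto_const_nhds) (hlim.comp hφ.tendsto_atTop)
  have hfb : Tendsto (fun n => f (u (φ n))) atTop (𝓝 (f b)) :=
    (hf b hbs).tendsto.comp
      (tendsto_nhdsWithin_iff.2 ⟨hb, Eventually.of_forall fun n => hu _⟩)
  have hfbd : dist (f b) a = d := by
    refine tendsto_nhds_unique (hfb.dist tendsto_const_nhds) ?_
    simp only [← hsucc]
    exact hlim.comp ((tendsto_add_atTop_nat 1).comp hφ.tendsto_atTop)
  have hba : b = a := by
    by_contra hne
    exact absurd (hlt b hbs hne) (by rw [hfbd, hbd]; exact lt_irrefl d)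
  rw [hba, dist_self] at hbd
  rw [tendsto_iff_dist_tendsto_zero, hbd]
  exact hlim

/-- One policing update strictly decreases the distance to the equilibrium. -/
theorem abs_policing_update_sub_lt {α K : ℝ} (hα0 : 0 < α) {h : ℝ → ℝ}
    (hanti : StrictAntiOn h (Set.Icc 0 1))
    (hlip : ∀ p ∈ Set.Icc (0 : ℝ) 1, ∀ q ∈ Set.Icc (0 : ℝ) 1, |h p - h q| ≤ K * |p - q|)
    (hK : K < 2 / α) {P : ℝ} (hP : P ∈ Set.Ioo (0 : ℝ) 1) (hfix : h P = 1)
    {x : ℝ} (hx : 0 ≤ x) (hne : x ≠ P) :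
    |max 0 (x + α * (h (min x 1) - 1)) - P| < |x - P| := by
  have hP' : P ∈ Set.Icc (0 : ℝ) 1 := Set.Ioo_subset_Icc_self hP
  have hm : min x 1 ∈ Set.Icc (0 : ℝ) 1 := ⟨le_min hx zero_le_one, min_le_right _ _⟩
  have hαK : α * K < 2 := by rwa [lt_div_iff₀ hα0, mul_comm] at hK
  have hl := mul_le_mul_of_nonneg_left (hlip _ hm _ hP') hα0.le
  rw [hfix] at hl
  have hmax : |max 0 (x + α * (h (min x 1) - 1)) - P| ≤ |x + α * (h (min x 1) - 1) - P| := by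
    have := abs_max_sub_max_le_abs (x + α * (h (min x 1) - 1)) P 0
    rwa [max_eq_left hP.1.le, max_comm] at this
  refine hmax.trans_lt ?_
  rcases lt_or_gt_of_ne hne with hlt | hgt
  · rw [min_eq_left (hlt.trans hP.2).le] at *
    have hpos := hanti hm hP' hlt
    rw [hfix] at hpos
    rw [abs_of_pos (sub_pos.2 hpos), abs_of_neg (sub_neg.2 hlt)] at hl
    rw [abs_of_neg (sub_neg.2 hlt), abs_lt]
    constructor <;> nlinarith
  · have hmP : P < min x 1 := lt_min hgt hP.2
    have hneg := hanti hP' hm hmP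
    rw [hfix] at hneg
    rw [abs_of_neg (sub_neg.2 hneg), abs_of_pos (sub_pos.2 hmP)] at hl
    have hmx : min x 1 ≤ x := min_le_left _ _
    rw [abs_of_pos (sub_pos.2 hgt), abs_lt]
    constructor <;> nlinarith


/-- Theorem 2 (Moderately misbehaving stations): with `0 < α < 1`, `h` strictly
decreasing and Lipschitz (constant `K < 2/α`) on `[0,1]`, `h 0 > 1`, `h 1 < 1`,
and `P ∈ (0,1)` the unique point with `h P = 1`, the policing iteration
`p (t+1) = max 0 (p t + α * (h (min (p t) 1) - 1))` starting from `p 0 ≥ 0`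
converges to `P`, and the normalised attempt rate `h (min (p t) 1)` converges to `1`. -/
theorem policing_moderate_misbehaviour_converges
    (α K : ℝ) (hα0 : 0 < α) (hα1 : α < 1)
    (h : ℝ → ℝ) (hanti : StrictAntiOn h (Set.Icc 0 1))
    (hlip : ∀ p ∈ Set.Icc (0 : ℝ) 1, ∀ q ∈ Set.Icc (0 : ℝ) 1, |h p - h q| ≤ K * |p - q|)
    (hK : K < 2 / α) (h0 : 1 < h 0) (h1 : h 1 < 1)
    (P : ℝ) (hP : P ∈ Set.Ioo (0 : ℝ) 1) (hfix : h P = 1)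
    (p : ℕ → ℝ) (hp0 : 0 ≤ p 0)
    (hupd : ∀ t, p (t + 1) = max 0 (p t + α * (h (min (p t) 1) - 1))) :
    Filter.Tendsto p Filter.atTop (nhds P) ∧
      Filter.Tendsto (fun t => h (min (p t) 1)) Filter.atTop (nhds 1) := by
  have hmin : Set.MapsTo (fun x : ℝ => min x 1) (Set.Ici 0) (Set.Icc 0 1) :=
    fun x hx => ⟨le_min hx zero_le_one, min_le_right _ _⟩
  have hcont : ContinuousOn h (Set.Icc 0 1) :=
    (LipschitzOnWith.of_dist_le_mul (K := K.toNNReal) fun x hx y hy =>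
      (hlip x hx y hy).trans <|
        mul_le_mul_of_nonneg_right (Real.le_coe_toNNReal K) (abs_nonneg _)).continuousOn
  have hrate : ContinuousOn (fun x : ℝ => h (min x 1)) (Set.Ici 0) :=
    hcont.comp (continuous_id.min continuous_const).continuousOn hmin
  have hminP : min P 1 = P := min_eq_left hP.2.le
  have hp : ∀ n, p n ∈ Set.Ici (0 : ℝ) := by
    rintro (_ | n)
    · exact hp0
    · rw [Set.mem_Ici, hupd]
      exact le_max_left _ _
  have hlim : Filter.Tendsto p Filter.atTop (nhds P) :=
    tendsto_orbit_of_dist_lt isClosed_Ici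
      (f := fun x => max 0 (x + α * (h (min x 1) - 1)))
      (by fun_prop) (by simp [hminP, hfix, hP.1.le])
      (fun x hx hne => abs_policing_update_sub_lt hα0 hanti hlip hK hP hfix hx hne) hp hupd
  refine ⟨hlim, ?_⟩
  have := (hrate P hP.1.le).tendsto.comp
    (tendsto_nhdsWithin_iff.2 ⟨hlim, Filter.Eventually.of_forall hp⟩)
  simpa only [hminP, hfix, Function.comp_def] using this
end
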